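/- There exist functions a, b : ℕ → ℕ → ℤ such that for all natural numbers r, s, J_{rs} = b(r,s) · ζ(3) + a(r,s) / d_{max(r,s)}³, where d_m := lcm{1, 2, …, m}. -/

import Mathlib

open MeasureTheory

/-- `J r s = ∫_{(0,1)²} -log(xy)/(1-xy) · xʳ yˢ dμ`. -/
noncomputable def J (r s : ℕ) : ℝ :=
  ∫ x : ℝ × ℝ in Set.Ioo (0 : ℝ) 1 ×ˢ Set.Ioo (0 : ℝ) 1,
    -Real.log (x.1 * x.2) / (1 - x.1 * x.2) * x.1 ^ r * x.2 ^ s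


/-- `d m = lcm {1, 2, …, m}`. -/
def d (m : ℕ) : ℕ := (Finset.Icc 1 m).lcm id

theorem hasDerivAt_pow_mul_log_primitive (n : ℕ) {x : ℝ} (hx : x ≠ 0) :
    HasDerivAt (fun x : ℝ => x ^ (n + 1) / ((n : ℝ) + 1) ^ 2 - x ^ n * (x * Real.log x) / (n + 1))
      (x ^ n * -Real.log x) x := by
  have hn : (n : ℝ) + 1 ≠ 0 := by positivity
  have h : HasDerivAt
      (fun x : ℝ => x ^ (n + 1) / ((n : ℝ) + 1) ^ 2 - x ^ (n + 1) * Real.log x / (n + 1)) _ x :=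
    ((hasDerivAt_pow (n + 1) x).div_const _).sub
      (((hasDerivAt_pow (n + 1) x).mul (Real.hasDerivAt_log hx)).div_const _)
  convert h using 1
  · funext y
    ring
  · simp only [Nat.add_sub_cancel, Nat.cast_add, Nat.cast_one]
    field_simp
    ring

theorem continuous_pow_mul_log_primitive (n : ℕ) :
    Continuous
      (fun x : ℝ => x ^ (n + 1) / ((n : ℝ) + 1) ^ 2 - x ^ n * (x * Real.log x) / (n + 1)) := by
  have := Real.continuous_mul_log
  fun_prop

theorem intervalIntegrable_pow_mul_neg_log (n : ℕ) :
    IntervalIntegrable (fun x : ℝ => x ^ n * -Real.log x) volume 0 1 := by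
  rw [intervalIntegrable_iff_integrableOn_Ioc_of_le zero_le_one]
  refine intervalIntegral.integrableOn_deriv_of_nonneg
    (continuous_pow_mul_log_primitive n).continuousOn
    (fun x hx => hasDerivAt_pow_mul_log_primitive n hx.1.ne') fun x hx => ?_
  exact mul_nonneg (pow_nonneg hx.1.le _) (neg_nonneg.2 (Real.log_nonpos hx.1.le hx.2.le))

theorem integrableOn_pow_mul_neg_log (n : ℕ) :
    IntegrableOn (fun x : ℝ => x ^ n * -Real.log x) (Set.Ioo 0 1) :=
  ((intervalIntegrable_iff_integrableOn_Ioo_of_le zero_le_one).1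
    (intervalIntegrable_pow_mul_neg_log n))

theorem setIntegral_pow_mul_neg_log (n : ℕ) :
    ∫ x in Set.Ioo (0 : ℝ) 1, x ^ n * -Real.log x = 1 / ((n : ℝ) + 1) ^ 2 := by
  rw [← integral_Ioc_eq_integral_Ioo, ← intervalIntegral.integral_of_le zero_le_one,
    intervalIntegral.integral_eq_sub_of_hasDerivAt_of_le zero_le_one
      (continuous_pow_mul_log_primitive n).continuousOn
      (fun x hx => hasDerivAt_pow_mul_log_primitive n hx.1.ne')
      (intervalIntegrable_pow_mul_neg_log n)]
  simp

theorem integrableOn_pow_Ioo (n : ℕ) :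
    IntegrableOn (fun x : ℝ => x ^ n) (Set.Ioo 0 1) :=
  (continuous_pow n).integrableOn_Icc.mono_set Set.Ioo_subset_Icc_self

theorem setIntegral_pow_Ioo (n : ℕ) :
    ∫ x in Set.Ioo (0 : ℝ) 1, x ^ n = 1 / ((n : ℝ) + 1) := by
  rw [← integral_Ioc_eq_integral_Ioo, ← intervalIntegral.integral_of_le zero_le_one, integral_pow]
  simp

theorem eqOn_neg_log_mul_pow (m n : ℕ) :
    Set.EqOn (fun x : ℝ × ℝ => -Real.log (x.1 * x.2) * (x.1 ^ m * x.2 ^ n))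
      (fun x => x.1 ^ m * -Real.log x.1 * x.2 ^ n + x.1 ^ m * (x.2 ^ n * -Real.log x.2))
      (Set.Ioo (0 : ℝ) 1 ×ˢ Set.Ioo (0 : ℝ) 1) := by
  rintro x ⟨h1, h2⟩
  simp only
  rw [Real.log_mul h1.1.ne' h2.1.ne']
  ring

theorem integrableOn_mul_prod_Ioo {f g : ℝ → ℝ} (hf : IntegrableOn f (Set.Ioo 0 1))
    (hg : IntegrableOn g (Set.Ioo 0 1)) :
    IntegrableOn (fun x : ℝ × ℝ => f x.1 * g x.2) (Set.Ioo (0 : ℝ) 1 ×ˢ Set.Ioo (0 : ℝ) 1) := by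
  rw [IntegrableOn, Measure.volume_eq_prod, ← Measure.prod_restrict]
  exact Integrable.mul_prod hf hg

theorem integrableOn_neg_log_mul_pow (m n : ℕ) :
    IntegrableOn (fun x : ℝ × ℝ => -Real.log (x.1 * x.2) * (x.1 ^ m * x.2 ^ n))
      (Set.Ioo (0 : ℝ) 1 ×ˢ Set.Ioo (0 : ℝ) 1) := by
  rw [integrableOn_congr_fun (eqOn_neg_log_mul_pow m n) (measurableSet_Ioo.prod measurableSet_Ioo)]
  exact (integrableOn_mul_prod_Ioo (integrableOn_pow_mul_neg_log m) (integrableOn_pow_Ioo n)).add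
    (integrableOn_mul_prod_Ioo (integrableOn_pow_Ioo m) (integrableOn_pow_mul_neg_log n))

theorem setIntegral_neg_log_mul_pow (m n : ℕ) :
    ∫ x : ℝ × ℝ in Set.Ioo (0 : ℝ) 1 ×ˢ Set.Ioo (0 : ℝ) 1,
        -Real.log (x.1 * x.2) * (x.1 ^ m * x.2 ^ n) =
      1 / ((m : ℝ) + 1) ^ 2 * (1 / ((n : ℝ) + 1)) +
        1 / ((m : ℝ) + 1) * (1 / ((n : ℝ) + 1) ^ 2) := by
  rw [setIntegral_congr_fun (measurableSet_Ioo.prod measurableSet_Ioo) (eqOn_neg_log_mul_pow m n),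
    integral_add
      (integrableOn_mul_prod_Ioo (integrableOn_pow_mul_neg_log m) (integrableOn_pow_Ioo n))
      (integrableOn_mul_prod_Ioo (integrableOn_pow_Ioo m) (integrableOn_pow_mul_neg_log n)),
    Measure.volume_eq_prod,
    setIntegral_prod_mul (fun x : ℝ => x ^ m * -Real.log x) (fun y : ℝ => y ^ n),
    setIntegral_prod_mul (fun x : ℝ => x ^ m) (fun y : ℝ => y ^ n * -Real.log y),
    setIntegral_pow_mul_neg_log, setIntegral_pow_mul_neg_log, setIntegral_pow_Ioo,
    setIntegral_pow_Ioo]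

theorem summable_one_div_nat_add_one_pow {p : ℕ} (hp : 1 < p) :
    Summable (fun n : ℕ => 1 / ((n : ℝ) + 1) ^ p) := by
  simpa using (summable_nat_add_iff 1).2 (Real.summable_one_div_nat_pow.2 hp)

/-- Expanding `1 / (1 - x y)` as a geometric series writes `J r s` as a series. -/
theorem hasSum_J (r s : ℕ) :
    HasSum (fun k : ℕ => 1 / ((k : ℝ) + r + 1) ^ 2 * (1 / ((k : ℝ) + s + 1)) +
      1 / ((k : ℝ) + r + 1) * (1 / ((k : ℝ) + s + 1) ^ 2)) (J r s) := by
  have hmeas : MeasurableSet (Set.Ioo (0 : ℝ) 1 ×ˢ Set.Ioo (0 : ℝ) 1) :=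
    measurableSet_Ioo.prod measurableSet_Ioo
  have hint (k : ℕ) := setIntegral_neg_log_mul_pow (k + r) (k + s)
  push_cast at hint
  have hnorm (k : ℕ) : ∫ x : ℝ × ℝ in Set.Ioo (0 : ℝ) 1 ×ˢ Set.Ioo (0 : ℝ) 1,
      ‖-Real.log (x.1 * x.2) * (x.1 ^ (k + r) * x.2 ^ (k + s))‖ =
      1 / ((k : ℝ) + r + 1) ^ 2 * (1 / ((k : ℝ) + s + 1)) +
      1 / ((k : ℝ) + r + 1) * (1 / ((k : ℝ) + s + 1) ^ 2) := by
    rw [← hint k]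
    refine setIntegral_congr_fun hmeas fun x ⟨⟨h1, h1'⟩, h2, h2'⟩ => ?_
    have hlog : Real.log (x.1 * x.2) ≤ 0 :=
      Real.log_nonpos (by positivity) (mul_le_one₀ h1'.le h2.le h2'.le)
    exact Real.norm_of_nonneg (mul_nonneg (neg_nonneg.2 hlog) (by positivity))
  have hsum : Summable (fun k : ℕ => 1 / ((k : ℝ) + r + 1) ^ 2 * (1 / ((k : ℝ) + s + 1)) +
      1 / ((k : ℝ) + r + 1) * (1 / ((k : ℝ) + s + 1) ^ 2)) := by
    refine Summable.of_nonneg_of_le (fun k => by positivity) (fun k => ?_)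
      ((summable_one_div_nat_add_one_pow (p := 3) (by norm_num)).mul_left 2)
    have hr : 1 / ((k : ℝ) + r + 1) ≤ 1 / ((k : ℝ) + 1) := by gcongr; simp
    have hs : 1 / ((k : ℝ) + s + 1) ≤ 1 / ((k : ℝ) + 1) := by gcongr; simp
    calc _ = (1 / ((k : ℝ) + r + 1)) ^ 2 * (1 / ((k : ℝ) + s + 1)) +
          1 / ((k : ℝ) + r + 1) * (1 / ((k : ℝ) + s + 1)) ^ 2 := by simp only [one_div_pow]
      _ ≤ (1 / ((k : ℝ) + 1)) ^ 2 * (1 / ((k : ℝ) + 1)) +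
          1 / ((k : ℝ) + 1) * (1 / ((k : ℝ) + 1)) ^ 2 := by gcongr
      _ = 2 * (1 / ((k : ℝ) + 1) ^ 3) := by rw [← one_div_pow]; ring
  have key := hasSum_integral_of_summable_integral_norm
    (fun k : ℕ => integrableOn_neg_log_mul_pow (k + r) (k + s))
    (by simpa only [hnorm] using hsum)
  simp only [hint] at key
  suffices hJ : J r s = ∫ x : ℝ × ℝ in Set.Ioo (0 : ℝ) 1 ×ˢ Set.Ioo (0 : ℝ) 1,
      ∑' k : ℕ, -Real.log (x.1 * x.2) * (x.1 ^ (k + r) * x.2 ^ (k + s)) from hJ ▸ key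
  refine setIntegral_congr_fun hmeas fun x ⟨⟨h1, h1'⟩, h2, h2'⟩ => ?_
  have hgeom := (hasSum_geometric_of_lt_one (mul_pos h1 h2).le
    (mul_lt_one_of_nonneg_of_lt_one_left h1.le h1' h2'.le)).mul_left
      (-Real.log (x.1 * x.2) * (x.1 ^ r * x.2 ^ s))
  have hterm (k : ℕ) : -Real.log (x.1 * x.2) * (x.1 ^ (k + r) * x.2 ^ (k + s)) =
      -Real.log (x.1 * x.2) * (x.1 ^ r * x.2 ^ s) * (x.1 * x.2) ^ k := by
    rw [mul_pow]
    ring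
  simp only [hterm, hgeom.tsum_eq]
  ring

theorem J_comm (r s : ℕ) : J r s = J s r := by
  refine (hasSum_J r s).unique ?_
  convert hasSum_J s r using 2
  ring

theorem J_self (r : ℕ) :
    J r r = 2 * ∑' n : ℕ, 1 / ((n : ℝ) + 1) ^ 3 -
      2 * ∑ j ∈ Finset.range r, 1 / ((j : ℝ) + 1) ^ 3 := by
  have h := (summable_one_div_nat_add_one_pow (p := 3) (by norm_num)).sum_add_tsum_nat_add r
  rw [← (hasSum_J r r).tsum_eq, ← h, mul_add, add_sub_cancel_left, ← tsum_mul_left]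
  refine tsum_congr fun k => ?_
  push_cast
  field_simp
  ring

theorem J_add_left (s m : ℕ) (hm : m ≠ 0) :
    J (s + m) s = 1 / (m : ℝ) * ∑ j ∈ Finset.range m, 1 / (((s + j : ℕ) : ℝ) + 1) ^ 2 := by
  have hsum : Summable (fun j : ℕ => 1 / (((s + j : ℕ) : ℝ) + 1) ^ 2) := by
    simpa only [add_comm s] using
      (summable_nat_add_iff s).2 (summable_one_div_nat_add_one_pow (p := 2) (by norm_num))
  have h := hsum.sum_add_tsum_nat_add m
  rw [← (hasSum_J (s + m) s).tsum_eq, eq_sub_of_add_eq h,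
    ← hsum.tsum_sub ((summable_nat_add_iff m).2 hsum), ← tsum_mul_left]
  refine tsum_congr fun k => ?_
  have hm' : (m : ℝ) ≠ 0 := Nat.cast_ne_zero.2 hm
  push_cast
  have h1 : (s : ℝ) + k + 1 ≠ 0 := by positivity
  have h2 : (s : ℝ) + (k + m) + 1 ≠ 0 := by positivity
  have e1 : (k : ℝ) + (s + m) + 1 = s + (k + m) + 1 := by ring
  have e2 : (k : ℝ) + s + 1 = s + k + 1 := by ring
  rw [e1, e2]
  field_simp
  ring

theorem d_ne_zero (m : ℕ) : d m ≠ 0 := by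
  simp [d, Finset.lcm_eq_zero_iff]

theorem cast_d_div {m j : ℕ} (h1 : 1 ≤ j) (h2 : j ≤ m) :
    ((d m / j : ℕ) : ℝ) = (d m : ℝ) / j :=
  Nat.cast_div (Finset.dvd_lcm (f := id) (Finset.mem_Icc.2 ⟨h1, h2⟩))
    (by positivity)

theorem exists_J_eq_of_le {r s : ℕ} (h : s ≤ r) :
    ∃ a b : ℤ, J r s = (b : ℝ) * ∑' n : ℕ, 1 / ((n : ℝ) + 1) ^ 3 + (a : ℝ) / (d r : ℝ) ^ 3 := by
  have hd : (d r : ℝ) ≠ 0 := Nat.cast_ne_zero.2 (d_ne_zero r)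
  obtain ⟨m, rfl⟩ := Nat.exists_eq_add_of_le h
  rcases eq_or_ne m 0 with rfl | hm
  · refine ⟨-2 * ((∑ j ∈ Finset.range s, (d s / (j + 1)) ^ 3 : ℕ) : ℤ), 2, ?_⟩
    simp only [add_zero] at hd ⊢
    have hq : ((∑ j ∈ Finset.range s, (d s / (j + 1)) ^ 3 : ℕ) : ℝ) =
        (d s : ℝ) ^ 3 * ∑ j ∈ Finset.range s, 1 / ((j : ℝ) + 1) ^ 3 := by
      rw [Nat.cast_sum, Finset.mul_sum]
      refine Finset.sum_congr rfl fun j hj => ?_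
      rw [Nat.cast_pow, cast_d_div (by lia) (Finset.mem_range.1 hj), Nat.cast_add_one,
        div_pow, mul_one_div]
    rw [J_self, Int.cast_mul, Int.cast_natCast, hq]
    push_cast
    field_simp
    ring
  · refine ⟨((d (s + m) / m * ∑ j ∈ Finset.range m, (d (s + m) / (s + j + 1)) ^ 2 : ℕ) : ℤ),
      0, ?_⟩
    have hq : ((∑ j ∈ Finset.range m, (d (s + m) / (s + j + 1)) ^ 2 : ℕ) : ℝ) =
        (d (s + m) : ℝ) ^ 2 * ∑ j ∈ Finset.range m, 1 / (((s + j : ℕ) : ℝ) + 1) ^ 2 := by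
      rw [Nat.cast_sum, Finset.mul_sum]
      refine Finset.sum_congr rfl fun j hj => ?_
      have := Finset.mem_range.1 hj
      rw [Nat.cast_pow, cast_d_div (by lia) (by lia), Nat.cast_add_one, div_pow,
        mul_one_div]
    rw [J_add_left s m hm, Int.cast_natCast, Nat.cast_mul, hq, cast_d_div (by lia) (by lia)]
    have hm' : (m : ℝ) ≠ 0 := Nat.cast_ne_zero.2 hm
    simp only [Int.cast_zero, zero_mul, zero_add]
    generalize ∑ j ∈ Finset.range m, 1 / (((s + j : ℕ) : ℝ) + 1) ^ 2 = S
    field_simp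

theorem linear_int_aux :
    ∃ a b : ℕ → ℕ → ℤ, ∀ r s : ℕ,
      J r s = (b r s : ℝ) * ∑' n : ℕ, 1 / ((n : ℝ) + 1) ^ 3 +
        (a r s : ℝ) / (d (max r s) : ℝ) ^ 3 := by
  have h (r s : ℕ) : ∃ a b : ℤ, J r s = (b : ℝ) * ∑' n : ℕ, 1 / ((n : ℝ) + 1) ^ 3 +
      (a : ℝ) / (d (max r s) : ℝ) ^ 3 := by
    rcases le_total s r with hsr | hrs
    · rw [max_eq_left hsr]
      exact exists_J_eq_of_le hsr
    · rw [max_eq_right hrs, J_comm]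
      exact exists_J_eq_of_le hrs
  choose a b hab using h
  exact ⟨a, b, hab⟩
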